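/- arXiv:2112.11228 — 3 statements merged into one kernel-verified Lean document; each statement's English description precedes it below -/
import Mathlib

section
/- For every n ≥ 0, ξ^{(2n)}(1/2) = 8·2^{2n}·b_n, where b_n = ∫_0^∞ t^{2n}·Φ(t) dt is the n-th Turán moment; equivalently a_{2n} = 8·2^{2n}·b_n/(2n)!. -/
/-- The Riemann xi function: `ξ(s) = (1/2)·s·(s−1)·π^{−s/2}·Γ(s/2)·ζ(s)`. -/
noncomputable def riemannXi (s : ℂ) : ℂ := (1 / 2) * s * (s - 1) * completedRiemannZeta s

/-- The `2n`-th Taylor coefficient of `ξ` at `s = 1/2`, a real number. -/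
noncomputable def a (n : ℕ) : ℝ :=
  (iteratedDeriv (2 * n) riemannXi (1 / 2)).re / (2 * n).factorial

/-- The kernel `Φ(t) = Σ_{k=1}^∞ (2k⁴π²e^{9t} − 3k²πe^{5t})·exp(−k²πe^{4t})`. -/
noncomputable def Phi (t : ℝ) : ℝ :=
  ∑' k : ℕ, (2 * ((k : ℝ) + 1) ^ 4 * Real.pi ^ 2 * Real.exp (9 * t)
      - 3 * ((k : ℝ) + 1) ^ 2 * Real.pi * Real.exp (5 * t)) *
    Real.exp (-(((k : ℝ) + 1) ^ 2) * Real.pi * Real.exp (4 * t))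

/-- The `n`-th Turán moment `b n = ∫_0^∞ t^{2n}·Φ(t) dt`. -/
noncomputable def turanMoment (n : ℕ) : ℝ :=
  ∫ t in Set.Ioi (0 : ℝ), t ^ (2 * n) * Phi t

section

open Real Set Filter Topology MeasureTheory Asymptotics

/-- The sum `∑_{k ≥ 1} k^{2j} exp(-π k² x)`; up to the factor `(-π)^j`, the `j`-th derivative of
`∑_{k ≥ 1} exp(-π k² x)`. -/
noncomputable def thetaSum (j : ℕ) (x : ℝ) : ℝ :=
  ∑' k : ℕ, (((k : ℝ) + 1) ^ 2) ^ j * exp (-π * ((k : ℝ) + 1) ^ 2 * x)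

lemma thetaSum_term_le {j m : ℕ} (hm : j + 1 ≤ m) {x : ℝ} (hx : 0 < x) (k : ℕ) :
    (((k : ℝ) + 1) ^ 2) ^ j * exp (-π * ((k : ℝ) + 1) ^ 2 * x) ≤
      m.factorial / x ^ m * (1 / ((k : ℝ) + 1) ^ 2) := by
  set w : ℝ := ((k : ℝ) + 1) ^ 2
  have hw1 : 1 ≤ w := one_le_pow₀ (by linarith [(Nat.cast_nonneg k : (0 : ℝ) ≤ k)])
  have hw0 : 0 < w := by linarith
  have hpi : 1 ≤ π := by linarith [pi_gt_three]
  have h1 : (w * x) ^ m / m.factorial ≤ exp (π * w * x) :=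
    (pow_div_factorial_le_exp _ (by positivity) m).trans
      (exp_le_exp.2 (by nlinarith [mul_pos hw0 hx]))
  have h2 : exp (-π * w * x) ≤ m.factorial / (w * x) ^ m := by
    rw [show -π * w * x = -(π * w * x) by ring, exp_neg, ← inv_div]
    exact inv_anti₀ (by positivity) h1
  calc w ^ j * exp (-π * w * x) ≤ w ^ j * (m.factorial / (w * x) ^ m) := by gcongr
    _ = m.factorial / x ^ m * (w ^ j / w ^ m) := by rw [mul_pow]; field
    _ ≤ m.factorial / x ^ m * (1 / w) := by
        gcongr ?_ * ?_
        rw [div_le_div_iff₀ (by positivity) hw0, one_mul, ← pow_succ]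
        exact pow_le_pow_right₀ hw1 hm

lemma summable_one_div_nat_add_one_sq : Summable fun k : ℕ ↦ 1 / ((k : ℝ) + 1) ^ 2 := by
  simpa using (summable_nat_add_iff 1).2 (Real.summable_one_div_nat_pow.2 one_lt_two)

lemma summable_thetaSum (j : ℕ) {x : ℝ} (hx : 0 < x) :
    Summable fun k : ℕ ↦ (((k : ℝ) + 1) ^ 2) ^ j * exp (-π * ((k : ℝ) + 1) ^ 2 * x) :=
  .of_nonneg_of_le (fun _ ↦ by positivity) (thetaSum_term_le le_rfl hx)
    (summable_one_div_nat_add_one_sq.mul_left _)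

lemma thetaSum_nonneg (j : ℕ) (x : ℝ) : 0 ≤ thetaSum j x :=
  tsum_nonneg fun _ ↦ by positivity

lemma exists_thetaSum_le {j m : ℕ} (hm : j + 1 ≤ m) :
    ∃ C, ∀ x, 0 < x → ‖thetaSum j x‖ ≤ C * ‖x ^ (-(m : ℝ))‖ := by
  refine ⟨m.factorial * ∑' k : ℕ, 1 / ((k : ℝ) + 1) ^ 2, fun x hx ↦ ?_⟩
  rw [norm_of_nonneg (thetaSum_nonneg j x), norm_of_nonneg (by positivity), rpow_neg hx.le,
    rpow_natCast]
  refine ((summable_thetaSum j hx).tsum_le_tsum (thetaSum_term_le hm hx)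
    (summable_one_div_nat_add_one_sq.mul_left _)).trans_eq ?_
  rw [tsum_mul_left]
  ring

lemma hasDerivAt_thetaSum (j : ℕ) {x : ℝ} (hx : 0 < x) :
    HasDerivAt (thetaSum j) (-π * thetaSum (j + 1) x) x := by
  have hx2 : x ∈ Ioi (x / 2) := half_lt_self hx
  have hderiv (k : ℕ) (y : ℝ) :
      HasDerivAt (fun y ↦ (((k : ℝ) + 1) ^ 2) ^ j * exp (-π * ((k : ℝ) + 1) ^ 2 * y))
        (-π * ((((k : ℝ) + 1) ^ 2) ^ (j + 1) * exp (-π * ((k : ℝ) + 1) ^ 2 * y))) y := by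
    refine (((hasDerivAt_id y).const_mul (-π * ((k : ℝ) + 1) ^ 2)).exp.const_mul
      ((((k : ℝ) + 1) ^ 2) ^ j)).congr_deriv ?_
    simp only [id]
    ring
  have hle (k : ℕ) (y : ℝ) (hy : y ∈ Ioi (x / 2)) :
      ‖-π * ((((k : ℝ) + 1) ^ 2) ^ (j + 1) * exp (-π * ((k : ℝ) + 1) ^ 2 * y))‖ ≤
        π * ((((k : ℝ) + 1) ^ 2) ^ (j + 1) * exp (-π * ((k : ℝ) + 1) ^ 2 * (x / 2))) := by
    have : -π * ((k : ℝ) + 1) ^ 2 * y ≤ -π * ((k : ℝ) + 1) ^ 2 * (x / 2) :=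
      mul_le_mul_of_nonpos_left (le_of_lt hy)
        (mul_nonpos_of_nonpos_of_nonneg (neg_nonpos.2 pi_pos.le) (sq_nonneg _))
    rw [norm_mul, norm_neg, norm_of_nonneg pi_pos.le, norm_of_nonneg (by positivity)]
    gcongr
  have h := hasDerivAt_tsum_of_isPreconnected
    ((summable_thetaSum (j + 1) (half_pos hx)).mul_left π) isOpen_Ioi isPreconnected_Ioi
    (fun k y _ ↦ hderiv k y) hle hx2 (summable_thetaSum j hx) hx2
  rw [tsum_mul_left] at h
  exact h

/-- The function of `x = exp (4 * t)` underlying `Φ`: one has `Φ(t) = exp(t) · xiKernel(exp(4t))`. -/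
noncomputable def xiKernel (x : ℝ) : ℝ :=
  2 * π ^ 2 * (x ^ 2 * thetaSum 2 x) - 3 * π * (x * thetaSum 1 x)

lemma Phi_eq (t : ℝ) : Phi t = exp t * xiKernel (exp (4 * t)) := by
  have h9 : exp (9 * t) = exp t * exp (4 * t) ^ 2 := by
    rw [← exp_nat_mul, ← exp_add]; congr 1; push_cast; ring
  have h5 : exp (5 * t) = exp t * exp (4 * t) := by rw [← exp_add]; congr 1; ring
  rw [Phi, xiKernel, thetaSum, thetaSum, ← tsum_mul_left, ← tsum_mul_left, ← tsum_mul_left,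
    ← tsum_mul_left, ← Summable.tsum_sub, ← tsum_mul_left]
  · refine tsum_congr fun k ↦ ?_
    rw [h9, h5, show -((k : ℝ) + 1) ^ 2 * π = -π * ((k : ℝ) + 1) ^ 2 by ring]
    ring
  · exact ((summable_thetaSum 2 (exp_pos _)).mul_left _).mul_left _
  · exact ((summable_thetaSum 1 (exp_pos _)).mul_left _).mul_left _

/-- The function `exp(t) · θ(exp(4t))`, where `θ(x) = ∑_{k ∈ ℤ} exp(-π k² x)`. -/
noncomputable def evenTheta (t : ℝ) : ℝ := exp t * (1 + 2 * thetaSum 0 (exp (4 * t)))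

lemma evenTheta_neg (t : ℝ) : evenTheta (-t) = evenTheta t := by
  have key : ∀ x : ℝ, 0 < x → 1 + 2 * thetaSum 0 x = HurwitzZeta.cosKernel 0 x := fun x hx ↦ by
    have h := (HurwitzZeta.hasSum_nat_cosKernel₀ 0 hx).tsum_eq
    simp only [mul_zero, zero_mul, cos_zero, mul_one, QuotientAddGroup.mk_zero, tsum_mul_left] at h
    simp only [thetaSum, pow_zero, one_mul]
    linarith
  rw [evenTheta, evenTheta, key _ (exp_pos _), key _ (exp_pos _),
    ← HurwitzZeta.evenKernel_eq_cosKernel_of_zero, HurwitzZeta.evenKernel_functional_equation 0,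
    ← HurwitzZeta.evenKernel_eq_cosKernel_of_zero, ← mul_assoc]
  congr 1
  · rw [← exp_mul, one_div, ← exp_neg, ← exp_add]; congr 1; ring
  · rw [one_div, ← exp_neg]; congr 2; ring

lemma hasDerivAt_exp_four_mul (t : ℝ) : HasDerivAt (fun t ↦ exp (4 * t)) (4 * exp (4 * t)) t := by
  simpa [mul_comm] using ((hasDerivAt_id t).const_mul 4).exp

lemma hasDerivAt_thetaSum_exp (j : ℕ) (t : ℝ) :
    HasDerivAt (fun t ↦ thetaSum j (exp (4 * t)))
      (-4 * π * exp (4 * t) * thetaSum (j + 1) (exp (4 * t))) t := by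
  refine ((hasDerivAt_thetaSum j (exp_pos (4 * t))).comp t
    (hasDerivAt_exp_four_mul t)).congr_deriv ?_
  ring

lemma deriv_evenTheta : deriv evenTheta = fun t ↦
    exp t * (1 + 2 * thetaSum 0 (exp (4 * t)) - 8 * π * (exp (4 * t) * thetaSum 1 (exp (4 * t)))) :=
  funext fun t ↦ by
    have := (hasDerivAt_exp t).mul (((hasDerivAt_thetaSum_exp 0 t).const_mul 2).const_add 1)
    refine this.deriv.trans ?_
    ring

lemma deriv_deriv_evenTheta (t : ℝ) :
    deriv (deriv evenTheta) t = evenTheta t + 16 * Phi t := by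
  rw [deriv_evenTheta]
  have := (hasDerivAt_exp t).mul ((((hasDerivAt_thetaSum_exp 0 t).const_mul 2).const_add 1).sub
    (((hasDerivAt_exp_four_mul t).mul (hasDerivAt_thetaSum_exp 1 t)).const_mul (8 * π)))
  refine this.deriv.trans ?_
  rw [Phi_eq, evenTheta, xiKernel]
  simp only [Pi.mul_apply, Pi.sub_apply]
  ring

lemma Phi_neg (t : ℝ) : Phi (-t) = Phi t := by
  have h0 : (fun t ↦ evenTheta (-t)) = evenTheta := funext evenTheta_neg
  have h1 (t : ℝ) : deriv evenTheta (-t) = -deriv evenTheta t := by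
    have := deriv_comp_neg evenTheta t
    rw [h0] at this
    linarith
  have h2 : deriv (deriv evenTheta) (-t) = deriv (deriv evenTheta) t := by
    have := deriv_comp_neg (deriv evenTheta) t
    rw [funext h1, deriv.fun_neg] at this
    linarith
  have := deriv_deriv_evenTheta t
  have := deriv_deriv_evenTheta (-t)
  have := evenTheta_neg t
  linarith

lemma xiKernel_one_div {x : ℝ} (hx : 0 < x) : xiKernel (1 / x) = x ^ (1 / 2 : ℝ) * xiKernel x := by
  have h := Phi_neg (log x / 4)
  rw [Phi_eq, Phi_eq, show 4 * -(log x / 4) = -log x by ring, show 4 * (log x / 4) = log x by ring,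
    exp_neg (log x), exp_log hx, exp_neg, inv_mul_eq_iff_eq_mul₀ (exp_ne_zero _), ← mul_assoc,
    ← exp_add] at h
  rw [one_div, h, rpow_def_of_pos hx]
  congr 2
  ring

lemma continuousOn_thetaSum (j : ℕ) : ContinuousOn (thetaSum j) (Ioi 0) :=
  fun _ hx ↦ (hasDerivAt_thetaSum j hx).continuousAt.continuousWithinAt

lemma continuousOn_xiKernel : ContinuousOn xiKernel (Ioi 0) := by
  have h1 := continuousOn_thetaSum 1
  have h2 := continuousOn_thetaSum 2
  unfold xiKernel
  fun_prop

lemma thetaSum_isBigO {j m : ℕ} (hm : j + 1 ≤ m) {l : Filter ℝ} (hl : ∀ᶠ x in l, 0 < x) :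
    thetaSum j =O[l] fun x ↦ x ^ (-(m : ℝ)) :=
  let ⟨C, hC⟩ := exists_thetaSum_le hm
  .of_bound C (hl.mono hC)

lemma pow_mul_thetaSum_isBigO (i : ℕ) {j m : ℕ} (hm : j + 1 ≤ m) {l : Filter ℝ}
    (hl : ∀ᶠ x in l, 0 < x) :
    (fun x ↦ x ^ i * thetaSum j x) =O[l] fun x ↦ x ^ (-((m : ℝ) - i)) := by
  refine ((isBigO_refl (fun x : ℝ ↦ x ^ i) l).mul (thetaSum_isBigO hm hl)).congr' .rfl ?_
  filter_upwards [hl] with x hx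
  rw [← rpow_natCast, ← rpow_add hx]
  congr 1
  ring

lemma xiKernel_isBigO_atTop (r : ℝ) : xiKernel =O[atTop] fun x ↦ x ^ r := by
  obtain ⟨m, hm⟩ := exists_nat_ge (2 - r)
  have key (i j : ℕ) (hi : i ≤ 2) : (fun x ↦ x ^ i * thetaSum j x) =O[atTop] fun x ↦ x ^ r := by
    refine (pow_mul_thetaSum_isBigO i (Nat.le_add_left (j + 1) m) (eventually_gt_atTop 0)).trans ?_
    refine .of_bound 1 ?_
    filter_upwards [eventually_ge_atTop 1] with x hx
    rw [one_mul, norm_of_nonneg (by positivity), norm_of_nonneg (by positivity)]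
    refine rpow_le_rpow_of_exponent_le hx ?_
    have : (i : ℝ) ≤ 2 := mod_cast hi
    push_cast
    linarith [(Nat.cast_nonneg j : (0 : ℝ) ≤ j)]
  have h1 := key 1 1 one_le_two
  simp only [pow_one] at h1
  exact ((key 2 2 le_rfl).const_mul_left _).sub (h1.const_mul_left _)

/-- The self-dual functional equation of `xiKernel`. -/
noncomputable def xiFEPair : WeakFEPair ℂ where
  f x := xiKernel x
  g x := xiKernel x
  k := 1 / 2
  ε := 1
  f₀ := 0
  g₀ := 0
  hf_int := (Complex.continuous_ofReal.comp_continuousOn continuousOn_xiKernel).locallyIntegrableOn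
    measurableSet_Ioi
  hg_int := (Complex.continuous_ofReal.comp_continuousOn continuousOn_xiKernel).locallyIntegrableOn
    measurableSet_Ioi
  hk := by norm_num
  hε := one_ne_zero
  h_feq x hx := by
    rw [xiKernel_one_div hx, one_mul, smul_eq_mul, Complex.ofReal_mul]
  hf_top r := by simpa only [sub_zero, Complex.isBigO_ofReal_left] using xiKernel_isBigO_atTop r
  hg_top r := by simpa only [sub_zero, Complex.isBigO_ofReal_left] using xiKernel_isBigO_atTop r

lemma xiKernel_isBigO_nhdsGT_zero (r : ℝ) : xiKernel =O[𝓝[>] 0] fun x ↦ x ^ r :=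
  Complex.isBigO_ofReal_left.1 ((⟨rfl, rfl⟩ : IsStrongFEPair xiFEPair).hf_zero r)

lemma log_pow_mul_xiKernel_isBigO_atTop (k : ℕ) (r : ℝ) :
    (fun x ↦ log x ^ k * xiKernel x) =O[atTop] fun x ↦ x ^ r := by
  refine (((isLittleO_log_rpow_atTop one_pos).isBigO.pow k).mul
    (xiKernel_isBigO_atTop (r - k))).congr' .rfl ?_
  filter_upwards [eventually_gt_atTop 0] with x hx
  rw [rpow_one, ← rpow_natCast, ← rpow_add hx, add_sub_cancel]

lemma log_pow_mul_xiKernel_isBigO_nhdsGT_zero (k : ℕ) (r : ℝ) :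
    (fun x ↦ log x ^ k * xiKernel x) =O[𝓝[>] 0] fun x ↦ x ^ r := by
  refine (((isLittleO_log_rpow_nhdsGT_zero neg_one_lt_zero).isBigO.pow k).mul
    (xiKernel_isBigO_nhdsGT_zero (r + k))).congr' .rfl ?_
  filter_upwards [self_mem_nhdsWithin] with x (hx : 0 < x)
  rw [← rpow_natCast, ← rpow_mul hx.le, ← rpow_add hx]
  congr 1
  ring

lemma hasDerivAt_mellin_log_pow_mul_xiKernel (k : ℕ) (s : ℂ) :
    HasDerivAt (mellin fun x ↦ ((log x ^ k * xiKernel x : ℝ) : ℂ))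
      (mellin (fun x ↦ ((log x ^ (k + 1) * xiKernel x : ℝ) : ℂ)) s) s := by
  have hc : ContinuousOn (fun x ↦ ((log x ^ k * xiKernel x : ℝ) : ℂ)) (Ioi 0) :=
    Complex.continuous_ofReal.comp_continuousOn
      (((continuousOn_log.mono fun x (hx : 0 < x) ↦ hx.ne').pow k).mul continuousOn_xiKernel)
  have h := (mellin_hasDerivAt_of_isBigO_rpow (hc.locallyIntegrableOn measurableSet_Ioi)
    (Complex.isBigO_ofReal_left.2 (log_pow_mul_xiKernel_isBigO_atTop k (-(s.re + 1))))
    (lt_add_one _)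
    (Complex.isBigO_ofReal_left.2 (log_pow_mul_xiKernel_isBigO_nhdsGT_zero k (-(s.re - 1))))
    (sub_one_lt _)).2
  simpa only [Complex.real_smul, ← Complex.ofReal_mul, ← mul_assoc, ← pow_succ'] using h

lemma iteratedDeriv_mellin_xiKernel_div_two (k : ℕ) :
    iteratedDeriv k (fun s ↦ mellin (fun x ↦ (xiKernel x : ℂ)) (s / 2)) =
      fun s ↦ mellin (fun x ↦ ((log x ^ k * xiKernel x : ℝ) : ℂ)) (s / 2) / 2 ^ k := by
  induction k with
  | zero => simp
  | succ k ih =>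
    rw [iteratedDeriv_succ, ih]
    funext s
    refine (((hasDerivAt_mellin_log_pow_mul_xiKernel k (s / 2)).comp s
      ((hasDerivAt_id s).div_const 2)).div_const (2 ^ k)).deriv.trans ?_
    rw [pow_succ]
    ring

lemma mellin_thetaSum (j : ℕ) {s : ℂ} (hs : 1 < s.re) :
    mellin (fun x ↦ (thetaSum j x : ℂ)) (s + j) =
      Complex.Gamma (s + j) * (π : ℂ) ^ (-(s + j)) * riemannZeta (2 * s) := by
  have hre : (s + j).re = s.re + j := by simp
  have h := hasSum_mellin (a := fun k : ℕ ↦ ((((k : ℝ) + 1) ^ 2) ^ j : ℝ))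
    (p := fun k : ℕ ↦ π * ((k : ℝ) + 1) ^ 2) (F := fun x ↦ (thetaSum j x : ℂ)) (s := s + j)
    (fun k ↦ .inr (by positivity)) (by rw [hre]; positivity)
    (fun t ht ↦ by
      have := (summable_thetaSum j ht).hasSum
      rw [← Complex.hasSum_ofReal] at this
      simpa only [thetaSum, Complex.ofReal_mul, neg_mul] using this)
    (by
      refine .of_nonneg_of_le (fun _ ↦ by positivity) (fun k ↦ ?_) summable_one_div_nat_add_one_sq
      set w : ℝ := ((k : ℝ) + 1) ^ 2
      have hw1 : 1 ≤ w := one_le_pow₀ (by linarith [(Nat.cast_nonneg k : (0 : ℝ) ≤ k)])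
      have hw0 : 0 < w := by linarith
      rw [Complex.norm_real, norm_of_nonneg (by positivity), hre,
        div_le_div_iff₀ (by positivity) hw0, one_mul, ← pow_succ, ← rpow_natCast]
      calc w ^ ((j + 1 : ℕ) : ℝ) ≤ w ^ (s.re + j) :=
            rpow_le_rpow_of_exponent_le hw1 (by push_cast; linarith)
        _ ≤ (π * w) ^ (s.re + j) :=
            rpow_le_rpow hw0.le (by nlinarith [pi_gt_three]) (by positivity))
  have h2s : 1 < (2 * s).re := by
    rw [Complex.mul_re]
    norm_num
    linarith
  rw [← h.tsum_eq, zeta_eq_tsum_one_div_nat_add_one_cpow h2s, ← tsum_mul_left]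
  refine tsum_congr fun k ↦ ?_
  have hk : ((k : ℂ) + 1) ≠ 0 := by exact_mod_cast k.succ_ne_zero
  have hsq : (((((k : ℝ) + 1) ^ 2 : ℝ)) : ℂ) ^ (s + j) =
      ((k : ℂ) + 1) ^ (2 * s) * (((k : ℂ) + 1) ^ 2) ^ j := by
    have hk' : (((k : ℝ) + 1 : ℝ) : ℂ) = (k : ℂ) + 1 := by push_cast; rfl
    rw [Complex.ofReal_pow, hk', Complex.cpow_add _ _ (pow_ne_zero 2 hk), Complex.cpow_natCast,
      two_mul, Complex.cpow_add _ _ hk, ← hk', sq,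
      Complex.mul_cpow_ofReal_nonneg (by positivity) (by positivity)]
  rw [Complex.ofReal_mul, Complex.mul_cpow_ofReal_nonneg pi_pos.le (by positivity), hsq,
    Complex.cpow_neg]
  push_cast
  have h1 : (π : ℂ) ^ (s + j) ≠ 0 := by simp [Complex.cpow_eq_zero_iff, pi_ne_zero]
  have h2 : ((k : ℂ) + 1) ^ (2 * s) ≠ 0 := by simp [Complex.cpow_eq_zero_iff, hk]
  field

lemma hasMellin_pow_mul_thetaSum (j : ℕ) {s : ℂ} (hs : 1 < s.re) :
    HasMellin (fun x ↦ ((x ^ j * thetaSum j x : ℝ) : ℂ)) s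
      (Complex.Gamma (s + j) * (π : ℂ) ^ (-(s + j)) * riemannZeta (2 * s)) := by
  have hc : ContinuousOn (fun x ↦ ((x ^ j * thetaSum j x : ℝ) : ℂ)) (Ioi 0) :=
    Complex.continuous_ofReal.comp_continuousOn
      ((continuousOn_id.pow j).mul (continuousOn_thetaSum j))
  obtain ⟨m, hm⟩ := exists_nat_ge (s.re)
  refine ⟨mellinConvergent_of_isBigO_rpow (hc.locallyIntegrableOn measurableSet_Ioi)
    (Complex.isBigO_ofReal_left.2 (pow_mul_thetaSum_isBigO j (m := m + j + 1) (by lia)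
      (eventually_gt_atTop 0))) (by push_cast; linarith)
    (Complex.isBigO_ofReal_left.2 (pow_mul_thetaSum_isBigO j le_rfl self_mem_nhdsWithin))
    (by push_cast; linarith), ?_⟩
  rw [← mellin_thetaSum j hs, ← mellin_cpow_smul]
  simp

lemma mellin_xiKernel {s : ℂ} (hs : 2 < s.re) :
    mellin (fun x ↦ (xiKernel x : ℂ)) (s / 2) = riemannXi s := by
  have hs0 : s ≠ 0 := by rintro rfl; norm_num at hs
  have hs2 : 1 < (s / 2).re := by
    rw [show (s / 2).re = s.re / 2 by simp]
    linarith
  have hpi : (π : ℂ) ≠ 0 := Complex.ofReal_ne_zero.2 pi_ne_zero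
  have h2 := hasMellin_pow_mul_thetaSum 2 hs2
  have h1 := hasMellin_pow_mul_thetaSum 1 hs2
  have h := (hasMellin_sub (h2.1.const_smul (2 * π ^ 2 : ℂ)) (h1.1.const_smul (3 * π : ℂ))).2
  rw [mellin_const_smul, mellin_const_smul, h2.2, h1.2] at h
  have hG1 : Complex.Gamma (s / 2 + 1) = s / 2 * Complex.Gamma (s / 2) :=
    Complex.Gamma_add_one _ (div_ne_zero hs0 two_ne_zero)
  have hG2 : Complex.Gamma (s / 2 + 2) = (s / 2 + 1) * (s / 2 * Complex.Gamma (s / 2)) := by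
    rw [show s / 2 + 2 = s / 2 + 1 + 1 by ring, Complex.Gamma_add_one, hG1]
    intro h0
    have := congrArg Complex.re h0
    simp at this hs2
    linarith
  have hp1 : (π : ℂ) ^ (-(s / 2 + 1)) = (π : ℂ) ^ (-s / 2) / π := by
    rw [show -(s / 2 + 1) = -s / 2 - 1 by ring, Complex.cpow_sub _ _ hpi, Complex.cpow_one]
  have hp2 : (π : ℂ) ^ (-(s / 2 + 2)) = (π : ℂ) ^ (-s / 2) / π ^ 2 := by
    rw [show -(s / 2 + 2) = -s / 2 - 2 by ring, Complex.cpow_sub _ _ hpi, Complex.cpow_ofNat]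
  have hzeta : completedRiemannZeta s =
      (π : ℂ) ^ (-s / 2) * Complex.Gamma (s / 2) * riemannZeta s := by
    rw [riemannZeta_def_of_ne_zero hs0, ← Complex.Gammaℝ_def,
      mul_div_cancel₀ _ (Complex.Gammaℝ_ne_zero_of_re_pos (by linarith))]
  have hK : (fun x ↦ (xiKernel x : ℂ)) = fun x ↦
      (2 * π ^ 2 : ℂ) • ((x ^ 2 * thetaSum 2 x : ℝ) : ℂ) -
        (3 * π : ℂ) • ((x ^ 1 * thetaSum 1 x : ℝ) : ℂ) := by
    funext x
    simp [xiKernel]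
  rw [hK, h, riemannXi, hzeta, mul_div_cancel₀ s two_ne_zero]
  push_cast
  rw [hG1, hG2, hp1, hp2, smul_eq_mul, smul_eq_mul]
  field

lemma mellin_xiKernel_eq_completedRiemannZeta₀ :
    (fun s ↦ mellin (fun x ↦ (xiKernel x : ℂ)) (s / 2)) =
      fun s ↦ (s * (s - 1) * completedRiemannZeta₀ s + 1) / 2 := by
  have hM : Differentiable ℂ fun s ↦ mellin (fun x ↦ (xiKernel x : ℂ)) (s / 2) := fun s ↦ by
    have := hasDerivAt_mellin_log_pow_mul_xiKernel 0 (s / 2)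
    simp only [pow_zero, one_mul] at this
    exact (this.comp s ((hasDerivAt_id s).div_const 2)).differentiableAt
  have hZ : Differentiable ℂ fun s ↦ (s * (s - 1) * completedRiemannZeta₀ s + 1) / 2 := by
    have := differentiable_completedZeta₀
    fun_prop
  refine AnalyticOnNhd.eq_of_eventuallyEq (z₀ := 3) (fun s _ ↦ hM.analyticAt s)
    (fun s _ ↦ hZ.analyticAt s) ?_
  filter_upwards [(isOpen_lt continuous_const Complex.continuous_re).mem_nhds
    (show 2 < (3 : ℂ).re by norm_num)] with s (hs : 2 < s.re)
  have hs0 : s ≠ 0 := by rintro rfl; norm_num at hs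
  have hs1 : 1 - s ≠ 0 := by
    intro h
    rw [← sub_eq_zero.1 h] at hs
    norm_num at hs
  rw [mellin_xiKernel hs, riemannXi, completedRiemannZeta_eq]
  field_simp
  ring

lemma riemannXi_eventuallyEq {s : ℂ} (hs0 : s ≠ 0) (hs1 : s ≠ 1) :
    riemannXi =ᶠ[𝓝 s] fun s ↦ mellin (fun x ↦ (xiKernel x : ℂ)) (s / 2) := by
  rw [mellin_xiKernel_eq_completedRiemannZeta₀]
  filter_upwards [isOpen_ne.mem_nhds hs0, isOpen_ne.mem_nhds hs1] with z hz0 hz1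
  have : 1 - z ≠ 0 := sub_ne_zero.2 (Ne.symm hz1)
  rw [riemannXi, completedRiemannZeta_eq]
  have : z ≠ 0 := hz0
  field_simp
  ring

lemma integral_Ioi_eq_integral_exp_four_mul (g : ℝ → ℝ) :
    ∫ x in Ioi 0, g x = ∫ t, 4 * exp (4 * t) * g (exp (4 * t)) := by
  have himage : (fun t ↦ exp (4 * t)) '' univ = Ioi 0 := by
    rw [image_univ]
    ext x
    refine ⟨?_, fun hx ↦ ⟨log x / 4, ?_⟩⟩
    · rintro ⟨t, rfl⟩
      exact exp_pos _
    · beta_reduce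
      rw [mul_div_cancel₀ _ four_ne_zero]
      exact exp_log hx
  have hinj : InjOn (fun t ↦ exp (4 * t)) univ := fun _ _ _ _ h ↦
    mul_left_cancel₀ four_ne_zero (exp_injective h)
  rw [← himage, integral_image_eq_integral_abs_deriv_smul MeasurableSet.univ
    (fun t _ ↦ (hasDerivAt_exp_four_mul t).hasDerivWithinAt) hinj, setIntegral_univ]
  refine integral_congr_ae (.of_forall fun t ↦ ?_)
  simp only [smul_eq_mul]
  rw [abs_of_pos (by positivity)]

lemma mellin_log_pow_mul_xiKernel_quarter (n : ℕ) :
    mellin (fun x ↦ ((log x ^ (2 * n) * xiKernel x : ℝ) : ℂ)) (1 / 4) =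
      ((8 * 4 ^ (2 * n) * turanMoment n : ℝ) : ℂ) := by
  have hreal : mellin (fun x ↦ ((log x ^ (2 * n) * xiKernel x : ℝ) : ℂ)) (1 / 4) =
      ((∫ x in Ioi 0, x ^ (1 / 4 - 1 : ℝ) * (log x ^ (2 * n) * xiKernel x) : ℝ) : ℂ) := by
    rw [mellin, ← integral_complex_ofReal]
    refine setIntegral_congr_fun measurableSet_Ioi fun x (hx : 0 < x) ↦ ?_
    simp only [smul_eq_mul]
    rw [Complex.ofReal_mul (x ^ _), Complex.ofReal_cpow hx.le]
    push_cast
    rfl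
  have habs (t : ℝ) : |t| ^ (2 * n) * Phi |t| = t ^ (2 * n) * Phi t := by
    rcases abs_choice t with h | h <;> rw [h]
    rw [Phi_neg, (even_two_mul n).neg_pow]
  rw [hreal, integral_Ioi_eq_integral_exp_four_mul, turanMoment]
  congr 1
  have h := integral_comp_abs (f := fun t ↦ t ^ (2 * n) * Phi t)
  simp only [habs] at h
  rw [show 8 * 4 ^ (2 * n) * ∫ t in Ioi 0, t ^ (2 * n) * Phi t =
    4 * 4 ^ (2 * n) * (2 * ∫ t in Ioi 0, t ^ (2 * n) * Phi t) by ring, ← h, ← integral_const_mul]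
  refine integral_congr_ae (.of_forall fun t ↦ ?_)
  have he : exp (4 * t) * exp (4 * t) ^ (1 / 4 - 1 : ℝ) = exp t := by
    rw [← exp_mul, ← exp_add]
    congr 1
    ring
  simp only [log_exp, Phi_eq, mul_pow]
  rw [← he]
  ring

lemma iteratedDeriv_riemannXi_one_half (n : ℕ) :
    iteratedDeriv (2 * n) riemannXi (1 / 2) =
      ((8 * 2 ^ (2 * n) * turanMoment n : ℝ) : ℂ) := by
  rw [(riemannXi_eventuallyEq (by norm_num) (by norm_num)).iteratedDeriv_eq,
    iteratedDeriv_mellin_xiKernel_div_two]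
  simp only
  rw [show (1 / 2 / 2 : ℂ) = 1 / 4 by norm_num, mellin_log_pow_mul_xiKernel_quarter,
    show (4 : ℝ) = 2 * 2 by norm_num, mul_pow]
  push_cast
  field

end

theorem iteratedDeriv_xi_eq_turanMoment (n : ℕ) :
    iteratedDeriv (2 * n) riemannXi (1 / 2) =
      ((8 * 2 ^ (2 * n) * turanMoment n : ℝ) : ℂ) ∧
    a n = 8 * 2 ^ (2 * n) * turanMoment n / (2 * n).factorial := by
  refine ⟨iteratedDeriv_riemannXi_one_half n, ?_⟩
  rw [a, iteratedDeriv_riemannXi_one_half, Complex.ofReal_re]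
end

section
/- For every n ≥ 0, the even derivative ξ^{(2n)}(1/2) is a positive real number: its imaginary part is 0 and its real part is strictly positive. Equivalently, every Taylor coefficient a_{2n} of ξ at 1/2 is strictly positive. -/
section

open Real Set Filter Topology MeasureTheory Asymptotics HurwitzZeta

section ExponentialMoments

lemma integrableOn_pow_mul_exp_neg (m : ℕ) :
    IntegrableOn (fun t : ℝ ↦ t ^ m * rexp (-t)) (Ioi 0) := by
  refine (Real.GammaIntegral_convergent (s := m + 1) (by positivity)).congr_fun (fun t _ ↦ ?_)
    measurableSet_Ioi
  simp [mul_comm]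

lemma integral_pow_mul_exp_neg (m : ℕ) :
    ∫ t in Ioi (0 : ℝ), t ^ m * rexp (-t) = m.factorial := by
  rw [← Real.Gamma_nat_eq_factorial, Real.Gamma_eq_integral (by positivity)]
  refine setIntegral_congr_fun measurableSet_Ioi fun t _ ↦ ?_
  simp [mul_comm]

variable {q : ℝ → ℝ}

lemma AntitoneOn.integrableOn_pow_mul_exp_neg_mul (hq : AntitoneOn q (Ici 0))
    (hq0 : ∀ t, 0 ≤ t → 0 ≤ q t) (m : ℕ) :
    IntegrableOn (fun t ↦ t ^ m * rexp (-t) * q t) (Ioi 0) := by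
  refine (integrableOn_pow_mul_exp_neg m).mul_bdd (c := q 0) ?_ ?_
  · exact (aemeasurable_restrict_of_antitoneOn measurableSet_Ioi
      (hq.mono Ioi_subset_Ici_self)).aestronglyMeasurable
  · refine ae_restrict_of_forall_mem measurableSet_Ioi fun t (ht : 0 < t) ↦ ?_
    rw [norm_of_nonneg (hq0 t ht.le)]
    exact hq self_mem_Ici ht.le ht.le

/-- Chebyshev's inequality comparing moments of `exp (-t) * q t` with those of `exp (-t)`. -/
lemma AntitoneOn.integral_pow_add_two_mul_exp_neg_mul_le (hq : AntitoneOn q (Ici 0))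
    (hq0 : ∀ t, 0 ≤ t → 0 ≤ q t) (m : ℕ) :
    ∫ t in Ioi 0, t ^ (m + 2) * rexp (-t) * q t ≤
      (m + 2) * (m + 1) * ∫ t in Ioi 0, t ^ m * rexp (-t) * q t := by
  set C : ℝ := (m + 2) * (m + 1) with hC
  have hC0 : 0 ≤ C := by positivity
  have hI (k : ℕ) := integrableOn_pow_mul_exp_neg k
  have hJ (k : ℕ) := hq.integrableOn_pow_mul_exp_neg_mul hq0 k
  have key : ∫ t in Ioi 0, (t ^ (m + 2) * rexp (-t) * q t - C * (t ^ m * rexp (-t) * q t)) ≤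
      ∫ t in Ioi 0, q (√C) * (t ^ (m + 2) * rexp (-t) - C * (t ^ m * rexp (-t))) := by
    refine setIntegral_mono_on ((hJ _).sub ((hJ m).const_mul C))
      (((hI _).sub ((hI m).const_mul C)).const_mul _) measurableSet_Ioi fun t (ht : 0 < t) ↦ ?_
    have h : (t ^ 2 - C) * (q t - q (√C)) ≤ 0 := by
      rcases le_total t (√C) with h | h
      · exact mul_nonpos_of_nonpos_of_nonneg
          (sub_nonpos.2 ((Real.le_sqrt ht.le hC0).1 h))
          (sub_nonneg.2 (hq ht.le (Real.sqrt_nonneg C) h))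
      · exact mul_nonpos_of_nonneg_of_nonpos
          (sub_nonneg.2 ((Real.sqrt_le_left ht.le).1 h))
          (sub_nonpos.2 (hq (Real.sqrt_nonneg C) ht.le h))
    have h2 := mul_nonpos_of_nonneg_of_nonpos
      (mul_nonneg (pow_nonneg ht.le m) (Real.exp_pos (-t)).le) h
    ring_nf at h2 ⊢
    linarith
  rw [integral_const_mul, integral_sub (hJ _) ((hJ m).const_mul C),
    integral_sub (hI _) ((hI m).const_mul C), integral_const_mul, integral_const_mul,
    integral_pow_mul_exp_neg, integral_pow_mul_exp_neg, Nat.factorial_succ, Nat.factorial_succ] at key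
  push_cast at key
  have : ((m : ℝ) + 1 + 1) * ((m + 1) * m.factorial) - C * m.factorial = 0 := by rw [hC]; ring
  rw [this, mul_zero] at key
  linarith

lemma AntitoneOn.integral_exp_neg_mul_le (hq : AntitoneOn q (Ici 0))
    (hq0 : ∀ t, 0 ≤ t → 0 ≤ q t) :
    ∫ t in Ioi 0, t ^ 0 * rexp (-t) * q t ≤ q 0 := by
  calc ∫ t in Ioi 0, t ^ 0 * rexp (-t) * q t
      ≤ ∫ t in Ioi 0, t ^ 0 * rexp (-t) * q 0 := by
        refine setIntegral_mono_on (hq.integrableOn_pow_mul_exp_neg_mul hq0 0)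
          ((integrableOn_pow_mul_exp_neg 0).mul_const _) measurableSet_Ioi
          fun t (ht : 0 < t) ↦ ?_
        gcongr
        exact hq self_mem_Ici ht.le ht.le
    _ = q 0 := by rw [integral_mul_const, integral_pow_mul_exp_neg]; simp

lemma AntitoneOn.integral_pow_mul_exp_neg_mul_pos (hq : AntitoneOn q (Ici 0))
    (hq0 : ∀ t, 0 ≤ t → 0 < q t) (m : ℕ) :
    0 < ∫ t in Ioi 0, t ^ m * rexp (-t) * q t := by
  have hpos : ∀ t ∈ Ioi (0 : ℝ), 0 < t ^ m * rexp (-t) * q t := fun t (ht : 0 < t) ↦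
    mul_pos (by positivity) (hq0 t ht.le)
  rw [setIntegral_pos_iff_support_of_nonneg_ae
    (ae_restrict_of_forall_mem measurableSet_Ioi fun t ht ↦ (hpos t ht).le)
    (hq.integrableOn_pow_mul_exp_neg_mul (fun t ht ↦ (hq0 t ht).le) m)]
  rw [inter_eq_right.2 (show Ioi (0 : ℝ) ⊆ Function.support _ from fun t ht ↦ (hpos t ht).ne')]
  simp

end ExponentialMoments

section RapidDecay

/-- A function on the positive reals decaying faster than any power at `0` and at `∞`. -/
structure IsRapidDecay (f : ℝ → ℂ) : Prop where
  locallyIntegrableOn : LocallyIntegrableOn f (Ioi 0)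
  isBigO_top (r : ℝ) : f =O[atTop] (· ^ r)
  isBigO_zero (r : ℝ) : f =O[𝓝[>] 0] (· ^ r)

variable {f : ℝ → ℂ}

lemma IsRapidDecay.log_smul (hf : IsRapidDecay f) : IsRapidDecay fun t ↦ log t • f t where
  locallyIntegrableOn := hf.locallyIntegrableOn.continuousOn_smul isOpen_Ioi.isLocallyClosed
    (continuousOn_log.mono fun _ ht ↦ (mem_Ioi.1 ht).ne')
  isBigO_top r := by
    simpa using isBigO_rpow_top_log_smul (lt_add_one (-r)) (hf.isBigO_top _)
  isBigO_zero r := by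
    simpa using isBigO_rpow_zero_log_smul (sub_one_lt (-r)) (hf.isBigO_zero _)

lemma IsRapidDecay.hasDerivAt_mellin (hf : IsRapidDecay f) (s : ℂ) :
    HasDerivAt (mellin f) (mellin (fun t ↦ log t • f t) s) s :=
  (mellin_hasDerivAt_of_isBigO_rpow hf.locallyIntegrableOn (hf.isBigO_top _) (lt_add_one s.re)
    (hf.isBigO_zero _) (sub_one_lt s.re)).2

lemma IsRapidDecay.iteratedDeriv_mellin (hf : IsRapidDecay f) (k : ℕ) :
    iteratedDeriv k (mellin f) = mellin fun t ↦ log t ^ k • f t := by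
  induction k generalizing f with
  | zero => simp
  | succ k ih =>
    rw [iteratedDeriv_succ', funext fun s ↦ (hf.hasDerivAt_mellin s).deriv, ih hf.log_smul]
    simp only [pow_succ, mul_smul]

end RapidDecay

lemma mellin_ofReal_eq_integral (f : ℝ → ℂ) (σ : ℝ) :
    mellin f σ = ∫ u : ℝ, rexp (-σ * u) • f (rexp (-u)) := by
  rw [mellin_eq_fourier]
  simp [Real.fourier_eq']

lemma WeakFEPair.isRapidDecay_f_modif (P : WeakFEPair ℂ) : IsRapidDecay P.f_modif where
  locallyIntegrableOn := P.hf_modif_int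
  isBigO_top := P.isStrongFEPair_toStrongFEPair.hf_top
  isBigO_zero := P.isStrongFEPair_toStrongFEPair.hf_zero

section Kernel

lemma hasSum_cosKernel_zero_sub_one {x : ℝ} (hx : 0 < x) :
    HasSum (fun n : ℕ ↦ 2 * rexp (-π * (n + 1) ^ 2 * x)) (cosKernel 0 x - 1) := by
  simpa using hasSum_nat_cosKernel₀ 0 hx

lemma cosKernel_zero_sub_one_pos {x : ℝ} (hx : 0 < x) : 0 < cosKernel 0 x - 1 := by
  have h := hasSum_cosKernel_zero_sub_one hx
  rw [← h.tsum_eq]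
  exact h.summable.tsum_pos (fun n ↦ by positivity) 0 (by positivity)

lemma cosKernel_zero_one_sub_one_lt : cosKernel 0 1 - 1 < 4 := by
  have h := hasSum_geometric_two' (2 : ℝ)
  refine (hasSum_le (fun n ↦ ?_) (hasSum_cosKernel_zero_sub_one one_pos) h).trans_lt (by norm_num)
  have h1 : rexp (-π * (n + 1) ^ 2 * 1) ≤ rexp (-1) ^ (n + 1) := by
    rw [← Real.exp_nat_mul, Real.exp_le_exp]
    push_cast
    have := Real.pi_gt_three
    have hn : (0 : ℝ) ≤ n := n.cast_nonneg
    nlinarith [mul_nonneg hn hn]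
  have h2 : rexp (-1) ≤ 1 / 2 := by
    have := Real.exp_one_gt_d9
    rw [Real.exp_neg, inv_le_comm₀ (by positivity) (by norm_num)]
    linarith
  have h3 : rexp (-1) ^ (n + 1) ≤ (1 / 2) ^ (n + 1) := by gcongr
  have h4 : (2 : ℝ) / 2 / 2 ^ n = 2 * (1 / 2) ^ (n + 1) := by
    rw [pow_succ, one_div, inv_pow]
    field_simp
  linarith

/-- The theta kernel `θ - 1` in the logarithmic variable, scaled by `exp (5 t / 4)`. -/
noncomputable def scaledKernel (t : ℝ) : ℝ := rexp (5 / 4 * t) * (cosKernel 0 (rexp t) - 1)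

lemma scaledKernel_pos (t : ℝ) : 0 < scaledKernel t :=
  mul_pos (by positivity) (cosKernel_zero_sub_one_pos (by positivity))

lemma antitoneOn_scaledKernel : AntitoneOn scaledKernel (Ici 0) := by
  intro s (hs : 0 ≤ s) t _ hst
  refine hasSum_le (fun n ↦ ?_)
    ((hasSum_cosKernel_zero_sub_one (Real.exp_pos t)).mul_left (rexp (5 / 4 * t)))
    ((hasSum_cosKernel_zero_sub_one (Real.exp_pos s)).mul_left (rexp (5 / 4 * s)))
  rw [mul_left_comm, mul_left_comm _ 2, ← Real.exp_add, ← Real.exp_add]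
  gcongr 2 * rexp ?_
  have h1 : t - s ≤ rexp t - rexp s := by
    have h := Real.add_one_le_exp (t - s)
    have : rexp t = rexp s * rexp (t - s) := by rw [← Real.exp_add]; ring_nf
    nlinarith [Real.one_le_exp hs]
  have h2 : 3 ≤ π * ((n : ℝ) + 1) ^ 2 := by
    have := Real.pi_gt_three
    have hn : (0 : ℝ) ≤ n := n.cast_nonneg
    nlinarith [mul_nonneg hn hn, mul_nonneg hn Real.pi_pos.le]
  nlinarith

end Kernel

section Moments

/-- Moments of the theta kernel in the logarithmic variable. -/
noncomputable def thetaMoment (m : ℕ) : ℝ := ∫ t in Ioi 0, t ^ m * rexp (-t) * scaledKernel t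

lemma hurwitzEvenFEPair_zero_f_modif_exp {t : ℝ} (ht : 0 < t) :
    rexp (t / 4) • (hurwitzEvenFEPair 0).f_modif (rexp t) =
      ((rexp (-t) * scaledKernel t : ℝ) : ℂ) := by
  have h1 : 1 < rexp t := Real.one_lt_exp_iff.2 ht
  rw [WeakFEPair.f_modif, Pi.add_apply, indicator_of_mem (mem_Ioi.2 h1),
    indicator_of_notMem (notMem_Ioo_of_ge h1.le), scaledKernel, ← mul_assoc, ← Real.exp_add]
  rw [show -t + 5 / 4 * t = t / 4 by ring]
  simp [hurwitzEvenFEPair, evenKernel_eq_cosKernel_of_zero]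

lemma hurwitzEvenFEPair_zero_f_modif_exp_neg (t : ℝ) :
    rexp (-(t / 4)) • (hurwitzEvenFEPair 0).f_modif (rexp (-t)) =
      rexp (t / 4) • (hurwitzEvenFEPair 0).f_modif (rexp t) := by
  have h := (hurwitzEvenFEPair 0).hf_modif_FE (rexp t) (Real.exp_pos t)
  have h2 : (hurwitzEvenFEPair 0).g_modif = (hurwitzEvenFEPair 0).f_modif := by
    conv_rhs => rw [← hurwitzEvenFEPair_zero_symm]
    rfl
  rw [one_div, ← Real.exp_neg, h2] at h
  rw [h]
  change rexp (-(t / 4)) • ((1 : ℂ) * ↑(rexp t ^ (1 / 2 : ℝ))) • _ = _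
  rw [one_mul, ← Real.exp_mul, Complex.coe_smul, smul_smul, ← Real.exp_add]
  ring_nf

lemma iteratedDeriv_hurwitzEvenFEPair_Λ₀ (n : ℕ) :
    iteratedDeriv (2 * n) (hurwitzEvenFEPair 0).Λ₀ (1 / 4) =
      ((2 * thetaMoment (2 * n) : ℝ) : ℂ) := by
  rw [WeakFEPair.Λ₀, (WeakFEPair.isRapidDecay_f_modif _).iteratedDeriv_mellin,
    show (1 / 4 : ℂ) = ((1 / 4 : ℝ) : ℂ) by norm_num, mellin_ofReal_eq_integral, thetaMoment,
    ← integral_comp_abs, ← integral_complex_ofReal]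
  refine integral_congr_ae ?_
  filter_upwards [compl_mem_ae_iff.mpr (measure_singleton (0 : ℝ))] with u (hu : u ≠ 0)
  have h : rexp (-(u / 4)) • (hurwitzEvenFEPair 0).f_modif (rexp (-u)) =
      ((rexp (-|u|) * scaledKernel |u| : ℝ) : ℂ) := by
    rcases lt_or_gt_of_ne hu with h | h
    · rw [abs_of_neg h, ← hurwitzEvenFEPair_zero_f_modif_exp (neg_pos.2 h)]
      ring_nf
    · rw [abs_of_pos h, ← hurwitzEvenFEPair_zero_f_modif_exp h,
        hurwitzEvenFEPair_zero_f_modif_exp_neg]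
  rw [Real.log_exp, smul_comm, show -(1 / 4) * u = -(u / 4) by ring, h, mul_assoc,
    (even_two_mul n).pow_abs, (even_two_mul n).neg_pow, Complex.ofReal_mul (u ^ _),
    Complex.real_smul]

lemma thetaMoment_pos (m : ℕ) : 0 < thetaMoment m :=
  antitoneOn_scaledKernel.integral_pow_mul_exp_neg_mul_pos (fun t _ ↦ scaledKernel_pos t) m

lemma thetaMoment_add_two_le (m : ℕ) :
    thetaMoment (m + 2) ≤ (m + 2) * (m + 1) * thetaMoment m :=
  antitoneOn_scaledKernel.integral_pow_add_two_mul_exp_neg_mul_le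
    (fun t _ ↦ (scaledKernel_pos t).le) m

lemma thetaMoment_zero_lt : thetaMoment 0 < 4 := by
  refine (antitoneOn_scaledKernel.integral_exp_neg_mul_le
    (fun t _ ↦ (scaledKernel_pos t).le)).trans_lt ?_
  simpa [scaledKernel] using cosKernel_zero_one_sub_one_lt

end Moments

section TaylorCoefficients

lemma riemannXi_eq {s : ℂ} (hs : s ≠ 0) (hs' : s ≠ 1) :
    riemannXi s = 1 / 2 + (s ^ 2 - s) / 4 * (hurwitzEvenFEPair 0).Λ₀ (1 / 2 * s) := by
  have h1 : 1 - s ≠ 0 := sub_ne_zero.2 hs'.symm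
  rw [riemannXi, completedRiemannZeta_eq, completedRiemannZeta₀, completedHurwitzZetaEven₀,
    show s / 2 = 1 / 2 * s by ring]
  field_simp
  ring

lemma riemannXi_eventuallyEq_s10 : riemannXi =ᶠ[𝓝 (1 / 2)]
    fun s ↦ 1 / 2 + (s ^ 2 - s) / 4 * (hurwitzEvenFEPair 0).Λ₀ (1 / 2 * s) := by
  filter_upwards [isOpen_ne.mem_nhds (show (1 / 2 : ℂ) ≠ 0 by norm_num),
    isOpen_ne.mem_nhds (show (1 / 2 : ℂ) ≠ 1 by norm_num)] with s hs hs'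
  exact riemannXi_eq hs hs'

lemma riemannXi_one_half : riemannXi (1 / 2) = ((1 / 2 - thetaMoment 0 / 8 : ℝ) : ℂ) := by
  have h := iteratedDeriv_hurwitzEvenFEPair_Λ₀ 0
  rw [mul_zero, iteratedDeriv_zero] at h
  rw [riemannXi_eq (by norm_num) (by norm_num), show (1 / 2 * (1 / 2) : ℂ) = 1 / 4 by norm_num, h]
  push_cast
  ring

/-- Leibniz' rule for the product of `(s ^ 2 - s) / 4` with `G`, at the critical point `1 / 2`. -/
lemma iteratedDeriv_quadratic_mul {G : ℂ → ℂ} (hG : ContDiff ℂ ⊤ G) (m : ℕ) :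
    iteratedDeriv (m + 2) (fun s ↦ (s ^ 2 - s) / 4 * G s) (1 / 2) =
      (m + 2) * (m + 1) / 4 * iteratedDeriv m G (1 / 2) -
        iteratedDeriv (m + 2) G (1 / 2) / 16 := by
  have d1 : deriv (fun s : ℂ ↦ (s ^ 2 - s) / 4) = fun s ↦ (2 * s - 1) / 4 := by
    ext s
    simp
  have d2 : deriv (fun s : ℂ ↦ (2 * s - 1) / 4) = fun _ ↦ 1 / 2 := by
    ext s
    simp
    norm_num
  have d3 (k : ℕ) : iteratedDeriv (k + 3) (fun s : ℂ ↦ (s ^ 2 - s) / 4) = fun _ ↦ 0 := by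
    rw [iteratedDeriv_succ', d1, iteratedDeriv_succ', d2, iteratedDeriv_succ', deriv_const']
    ext s
    exact iteratedDeriv_fun_const_zero
  rw [iteratedDeriv_fun_mul (by fun_prop) (hG.contDiffAt.of_le le_top),
    Finset.sum_range_succ', Finset.sum_range_succ', Finset.sum_range_succ']
  have e2 : ((m + 2).choose 2 : ℂ) = (m + 2) * (m + 1) / 2 := by
    rw [Nat.cast_choose_two]
    push_cast
    ring
  have i1 : iteratedDeriv 1 (fun s : ℂ ↦ (s ^ 2 - s) / 4) (1 / 2) = 0 := by
    rw [iteratedDeriv_one, d1]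
    norm_num
  have i2 : iteratedDeriv 2 (fun s : ℂ ↦ (s ^ 2 - s) / 4) (1 / 2) = 1 / 2 := by
    rw [iteratedDeriv_succ', d1, iteratedDeriv_one, d2]
  simp only [add_assoc, Nat.reduceAdd, d3, zero_add, i1, i2, e2, iteratedDeriv_zero, mul_zero,
    zero_mul, Finset.sum_const_zero, Nat.choose_zero_right, Nat.add_sub_cancel, Nat.sub_zero]
  push_cast
  ring

lemma iteratedDeriv_riemannXi (n : ℕ) :
    iteratedDeriv (2 * (n + 1)) riemannXi (1 / 2) =
      ((((2 * n + 2) * (2 * n + 1) * (2 * thetaMoment (2 * n)) -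
        2 * thetaMoment (2 * n + 2) / 16) / 2 ^ (2 * n + 2) : ℝ) : ℂ) := by
  have hG : ContDiff ℂ ⊤ (hurwitzEvenFEPair 0).Λ₀ :=
    (hurwitzEvenFEPair 0).differentiable_Λ₀.contDiff
  have hG2 : ContDiff ℂ ⊤ fun s ↦ (hurwitzEvenFEPair 0).Λ₀ (1 / 2 * s) := by fun_prop
  have h0 := iteratedDeriv_hurwitzEvenFEPair_Λ₀ n
  have h1 := iteratedDeriv_hurwitzEvenFEPair_Λ₀ (n + 1)
  rw [mul_add, mul_one] at h1 ⊢
  rw [riemannXi_eventuallyEq_s10.iteratedDeriv_eq, iteratedDeriv_const_add (by lia),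
    iteratedDeriv_quadratic_mul hG2,
    iteratedDeriv_comp_const_mul (hG.of_le le_top), iteratedDeriv_comp_const_mul (hG.of_le le_top)]
  simp only [show (1 / 2 * (1 / 2) : ℂ) = 1 / 4 by norm_num, h0, h1]
  push_cast
  rw [one_div, inv_pow, inv_pow, pow_add]
  field_simp
  ring

lemma iteratedDeriv_riemannXi_eq_ofReal_pos (n : ℕ) :
    ∃ r : ℝ, 0 < r ∧ iteratedDeriv (2 * n) riemannXi (1 / 2) = r := by
  rcases n with _ | n
  · refine ⟨_, ?_, by rw [mul_zero, iteratedDeriv_zero, riemannXi_one_half]⟩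
    linarith [thetaMoment_zero_lt]
  · refine ⟨_, div_pos ?_ (by positivity), iteratedDeriv_riemannXi n⟩
    have h := thetaMoment_add_two_le (2 * n)
    push_cast at h
    have : 0 < (2 * (n : ℝ) + 2) * (2 * n + 1) * thetaMoment (2 * n) :=
      mul_pos (by positivity) (thetaMoment_pos _)
    linarith

end TaylorCoefficients

end

theorem even_derivs_xi_pos (n : ℕ) :
    (iteratedDeriv (2 * n) riemannXi (1 / 2)).im = 0 ∧
    0 < (iteratedDeriv (2 * n) riemannXi (1 / 2)).re ∧
    0 < a n := by
  obtain ⟨r, hr, h⟩ := iteratedDeriv_riemannXi_eq_ofReal_pos n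
  refine ⟨by rw [h, Complex.ofReal_im], by rwa [h, Complex.ofReal_re], ?_⟩
  rw [a, h, Complex.ofReal_re]
  positivity
end

section
/- The Euler–Mascheroni constant satisfies γ = log(4π) − 2 + 2^7 · Σ_{n=1}^∞ n·b_n/(2n)!, i.e. γ = log(4π) − 2 + 128·Σ_{n=1}^∞ n·b_n/(2n)!, where b_n are the Turán moments. -/
open Real Set Filter Topology MeasureTheory

/-- The solution `e^t·exp(-a e^{4t})` whose image under `D² - 1` is `8 * phiTerm a`. -/
noncomputable def thetaTerm (a t : ℝ) : ℝ := exp t * exp (-a * exp (4 * t))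

/-- The summand of `Phi` with `a = π k²`. -/
noncomputable def phiTerm (a t : ℝ) : ℝ :=
  (2 * a ^ 2 * exp (9 * t) - 3 * a * exp (5 * t)) * exp (-a * exp (4 * t))

/-- The first derivative of `thetaTerm a`. -/
noncomputable def thetaTermDeriv (a t : ℝ) : ℝ :=
  (exp t - 4 * a * exp (5 * t)) * exp (-a * exp (4 * t))

lemma hasDerivAt_exp_mul_const (c t : ℝ) :
    HasDerivAt (fun t ↦ exp (c * t)) (c * exp (c * t)) t := by
  simpa [mul_comm] using ((hasDerivAt_id t).const_mul c).exp

lemma hasDerivAt_exp_neg_mul_exp (a t : ℝ) :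
    HasDerivAt (fun t ↦ exp (-a * exp (4 * t)))
      (exp (-a * exp (4 * t)) * (-a * (4 * exp (4 * t)))) t :=
  ((hasDerivAt_exp_mul_const 4 t).const_mul (-a)).exp

lemma hasDerivAt_thetaTerm (a t : ℝ) :
    HasDerivAt (thetaTerm a) (thetaTermDeriv a t) t := by
  refine ((Real.hasDerivAt_exp t).mul (hasDerivAt_exp_neg_mul_exp a t)).congr_deriv ?_
  have h5 : exp (5 * t) = exp t * exp (4 * t) := by rw [← exp_add]; ring_nf
  rw [thetaTermDeriv, h5]
  ring

lemma hasDerivAt_thetaTermDeriv (a t : ℝ) :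
    HasDerivAt (thetaTermDeriv a) (8 * phiTerm a t + thetaTerm a t) t := by
  refine (((Real.hasDerivAt_exp t).sub ((hasDerivAt_exp_mul_const 5 t).const_mul (4 * a))).mul
    (hasDerivAt_exp_neg_mul_exp a t)).congr_deriv ?_
  have h5 : exp (5 * t) = exp t * exp (4 * t) := by rw [← exp_add]; ring_nf
  have h9 : exp (9 * t) = exp t * exp (4 * t) ^ 2 := by
    rw [sq, ← exp_add, ← exp_add]; ring_nf
  simp only [phiTerm, thetaTerm, Pi.sub_apply, h5, h9]
  ring

lemma exp_neg_half_mul_exp_le {a t : ℝ} (ha : 3 ≤ a) (ht : 0 ≤ t) :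
    exp (-(a * exp (4 * t) / 2)) ≤ exp (-(a / 2)) * exp (-6 * t) := by
  rw [← exp_add, exp_le_exp]
  nlinarith [add_one_le_exp (4 * t)]

lemma sq_mul_exp_neg_le {y : ℝ} (hy : 3 ≤ y) :
    y ^ 2 * exp (-y) ≤ 8 * exp (-(y / 2)) := by
  have h := quadratic_le_exp_of_nonneg (show 0 ≤ y / 2 by linarith)
  have h1 : exp (-y) = exp (-(y / 2)) * exp (-(y / 2)) := by rw [← exp_add]; ring_nf
  have h2 : exp (y / 2) * exp (-(y / 2)) = 1 := by rw [← exp_add]; simp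
  have h3 := exp_pos (-(y / 2))
  calc y ^ 2 * exp (-y) = y ^ 2 * exp (-(y / 2)) * exp (-(y / 2)) := by rw [h1]; ring
    _ ≤ (8 * exp (y / 2)) * exp (-(y / 2)) * exp (-(y / 2)) := by gcongr; nlinarith
    _ = 8 * exp (-(y / 2)) := by rw [mul_assoc 8, h2, mul_one]

lemma three_le_mul_exp {a t : ℝ} (ha : 3 ≤ a) (ht : 0 ≤ t) : 3 ≤ a * exp (4 * t) := by
  nlinarith [add_one_le_exp (4 * t)]

lemma sq_mul_exp_mul_exp_neg_le {a t : ℝ} (ha : 3 ≤ a) (ht : 0 ≤ t) :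
    exp t * ((a * exp (4 * t)) ^ 2 * exp (-(a * exp (4 * t)))) ≤
      8 * exp (-(a / 2)) * exp (-5 * t) := by
  calc _ ≤ exp t * (8 * (exp (-(a / 2)) * exp (-6 * t))) :=
        mul_le_mul_of_nonneg_left ((sq_mul_exp_neg_le (three_le_mul_exp ha ht)).trans
          (mul_le_mul_of_nonneg_left (exp_neg_half_mul_exp_le ha ht) (by norm_num)))
          (exp_pos t).le
    _ = 8 * exp (-(a / 2)) * (exp t * exp (-6 * t)) := by ring
    _ = _ := by rw [← exp_add]; ring_nf

lemma phiTerm_eq (a t : ℝ) : phiTerm a t =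
    exp t * ((2 * (a * exp (4 * t)) ^ 2 - 3 * (a * exp (4 * t))) * exp (-(a * exp (4 * t)))) := by
  have h5 : exp (5 * t) = exp t * exp (4 * t) := by rw [← exp_add]; ring_nf
  have h9 : exp (9 * t) = exp t * exp (4 * t) ^ 2 := by
    rw [sq, ← exp_add, ← exp_add]; ring_nf
  rw [phiTerm, h5, h9]
  ring_nf

lemma phiTerm_nonneg {a t : ℝ} (ha : 3 ≤ a) (ht : 0 ≤ t) : 0 ≤ phiTerm a t := by
  rw [phiTerm_eq]
  have := three_le_mul_exp ha ht
  have : 0 ≤ 2 * (a * exp (4 * t)) ^ 2 - 3 * (a * exp (4 * t)) := by nlinarith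
  positivity

lemma abs_phiTerm_le {a t : ℝ} (ha : 3 ≤ a) (ht : 0 ≤ t) :
    |phiTerm a t| ≤ 16 * exp (-(a / 2)) * exp (-5 * t) := by
  rw [abs_of_nonneg (phiTerm_nonneg ha ht), phiTerm_eq]
  calc _ ≤ exp t * ((2 * (a * exp (4 * t)) ^ 2) * exp (-(a * exp (4 * t)))) := by
        gcongr
        linarith [three_le_mul_exp ha ht]
    _ ≤ _ := by linarith [sq_mul_exp_mul_exp_neg_le ha ht]

lemma abs_thetaTerm_le {a t : ℝ} (ha : 3 ≤ a) (ht : 0 ≤ t) :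
    |thetaTerm a t| ≤ 16 * exp (-(a / 2)) * exp (-5 * t) := by
  rw [thetaTerm, abs_of_nonneg (by positivity), neg_mul]
  refine le_trans ?_ ((sq_mul_exp_mul_exp_neg_le ha ht).trans (by gcongr; norm_num))
  gcongr
  refine le_mul_of_one_le_left (exp_pos _).le ?_
  nlinarith [three_le_mul_exp ha ht]

lemma abs_thetaTermDeriv_le {a t : ℝ} (ha : 3 ≤ a) (ht : 0 ≤ t) :
    |thetaTermDeriv a t| ≤ 32 * exp (-(a / 2)) * exp (-5 * t) := by
  have h5 : exp (5 * t) = exp t * exp (4 * t) := by rw [← exp_add]; ring_nf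
  have h3 := three_le_mul_exp ha ht
  have h : thetaTermDeriv a t =
      -(exp t * ((4 * (a * exp (4 * t)) - 1) * exp (-(a * exp (4 * t))))) := by
    rw [thetaTermDeriv, h5]; ring_nf
  have h0 : 0 ≤ 4 * (a * exp (4 * t)) - 1 := by linarith
  rw [h, abs_neg, abs_of_nonneg (by positivity)]
  calc _ ≤ exp t * ((4 * (a * exp (4 * t)) ^ 2) * exp (-(a * exp (4 * t)))) := by
        gcongr
        nlinarith
    _ ≤ _ := by linarith [sq_mul_exp_mul_exp_neg_le ha ht]

lemma continuous_thetaTerm (a : ℝ) : Continuous (thetaTerm a) := by unfold thetaTerm; fun_prop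

lemma continuous_phiTerm (a : ℝ) : Continuous (phiTerm a) := by unfold phiTerm; fun_prop

lemma integrableOn_mul_of_exp_decay {w f : ℝ → ℝ} {C : ℝ}
    (hw : Continuous w) (hwb : ∀ t, 0 ≤ t → |w t| ≤ exp (2 * t)) (hf : ContinuousOn f (Ioi 0))
    (hfb : ∀ t, 0 ≤ t → |f t| ≤ C * exp (-5 * t)) :
    IntegrableOn (fun t ↦ w t * f t) (Ioi 0) := by
  have hint : IntegrableOn (fun t : ℝ ↦ C * exp (-3 * t)) (Ioi 0) :=
    (exp_neg_integrableOn_Ioi 0 (by norm_num : (0 : ℝ) < 3)).const_mul C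
  refine Integrable.mono' hint
    ((hw.continuousOn.mul hf).aestronglyMeasurable measurableSet_Ioi) ?_
  filter_upwards [ae_restrict_mem measurableSet_Ioi] with t ht
  rw [norm_eq_abs, abs_mul]
  calc _ ≤ exp (2 * t) * (C * exp (-5 * t)) :=
        mul_le_mul (hwb t ht.le) (hfb t ht.le) (abs_nonneg _) (exp_pos _).le
    _ = C * (exp (2 * t) * exp (-5 * t)) := by ring
    _ = _ := by rw [← exp_add]; ring_nf

section Series

variable {f : ℕ → ℝ → ℝ} {w : ℝ → ℝ} {u : ℕ → ℝ}

lemma summable_of_exp_decay (hu : Summable u)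
    (hfb : ∀ k t, 0 ≤ t → |f k t| ≤ u k * exp (-5 * t)) {t : ℝ} (ht : 0 ≤ t) :
    Summable fun k ↦ f k t := by
  have h : Summable fun k ↦ u k * exp (-5 * t) := hu.mul_right _
  exact h.of_norm_bounded fun k ↦ hfb k t ht

lemma abs_tsum_le_of_exp_decay (hu : Summable u)
    (hfb : ∀ k t, 0 ≤ t → |f k t| ≤ u k * exp (-5 * t)) {t : ℝ} (ht : 0 ≤ t) :
    |∑' k, f k t| ≤ (∑' k, u k) * exp (-5 * t) := by
  rw [← norm_eq_abs]
  exact tsum_of_norm_bounded (hu.hasSum.mul_right (exp (-5 * t))) fun k ↦ hfb k t ht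

lemma continuousOn_tsum_of_exp_decay (hf : ∀ k, Continuous (f k)) (hu : Summable u)
    (hfb : ∀ k t, 0 ≤ t → |f k t| ≤ u k * exp (-5 * t)) :
    ContinuousOn (fun t ↦ ∑' k, f k t) (Ioi 0) := by
  refine continuousOn_tsum (fun k ↦ (hf k).continuousOn) hu fun k t ht ↦ ?_
  have ht : 0 < t := ht
  have hk := (abs_nonneg _).trans (hfb k 0 le_rfl)
  rw [mul_zero, exp_zero, mul_one] at hk
  exact (hfb k t ht.le).trans (mul_le_of_le_one_right hk (exp_le_one_iff.2 (by linarith)))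

lemma integrableOn_mul_tsum_of_exp_decay
    (hw : Continuous w) (hwb : ∀ t, 0 ≤ t → |w t| ≤ exp (2 * t))
    (hf : ∀ k, Continuous (f k)) (hu : Summable u)
    (hfb : ∀ k t, 0 ≤ t → |f k t| ≤ u k * exp (-5 * t)) :
    IntegrableOn (fun t ↦ w t * ∑' k, f k t) (Ioi 0) :=
  integrableOn_mul_of_exp_decay hw hwb (continuousOn_tsum_of_exp_decay hf hu hfb)
    fun _ ↦ abs_tsum_le_of_exp_decay hu hfb

lemma hasSum_integral_mul_of_exp_decay
    (hw : Continuous w) (hwb : ∀ t, 0 ≤ t → |w t| ≤ exp (2 * t))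
    (hf : ∀ k, Continuous (f k)) (hu : Summable u)
    (hfb : ∀ k t, 0 ≤ t → |f k t| ≤ u k * exp (-5 * t)) :
    HasSum (fun k ↦ ∫ t in Ioi 0, w t * f k t) (∫ t in Ioi 0, w t * ∑' k, f k t) := by
  refine hasSum_integral_of_dominated_convergence
    (fun k t ↦ u k * exp (-3 * t)) (fun k ↦ (hw.mul (hf k)).aestronglyMeasurable)
    (fun k ↦ ?_) (ae_of_all _ fun t ↦ hu.mul_right _) ?_ ?_
  · filter_upwards [ae_restrict_mem measurableSet_Ioi] with t ht
    rw [norm_eq_abs, abs_mul]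
    have ht : 0 < t := ht
    calc |w t| * |f k t| ≤ exp (2 * t) * (u k * exp (-5 * t)) :=
          mul_le_mul (hwb t ht.le) (hfb k t ht.le) (abs_nonneg _) (exp_pos _).le
      _ = u k * (exp (2 * t) * exp (-5 * t)) := by ring
      _ = u k * exp (-3 * t) := by rw [← exp_add]; ring_nf
  · simp_rw [tsum_mul_right]
    exact (exp_neg_integrableOn_Ioi 0 (by norm_num : (0 : ℝ) < 3)).const_mul _
  · filter_upwards [ae_restrict_mem measurableSet_Ioi] with t ht
    have ht : 0 < t := ht
    exact (summable_of_exp_decay hu hfb ht.le).hasSum.mul_left (w t)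

end Series

lemma sinh_le_exp (t : ℝ) : sinh t ≤ exp t := by
  rw [sinh_eq]; linarith [exp_pos t, exp_pos (-t)]

lemma cosh_le_exp {t : ℝ} (ht : 0 ≤ t) : cosh t ≤ exp t := by
  rw [cosh_eq]; linarith [exp_le_exp.2 (show -t ≤ t by linarith)]

lemma mul_le_exp_two_mul {t x : ℝ} (hx : 0 ≤ x) (h : x ≤ exp t) :
    t * x ≤ exp (2 * t) := by
  rw [two_mul, exp_add]
  exact mul_le_mul (by linarith [add_one_le_exp t]) h hx (exp_pos t).le

lemma abs_mul_sinh_le {t : ℝ} (ht : 0 ≤ t) : |t * sinh t| ≤ exp (2 * t) := by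
  have hs := sinh_nonneg_iff.2 ht
  rw [abs_of_nonneg (mul_nonneg ht hs)]
  exact mul_le_exp_two_mul hs (sinh_le_exp t)

lemma abs_cosh_le {t : ℝ} (ht : 0 ≤ t) : |cosh t| ≤ exp (2 * t) := by
  rw [abs_of_pos (cosh_pos t)]
  exact (cosh_le_exp ht).trans (exp_le_exp.2 (by linarith))

lemma integral_mul_sinh_mul_phiTerm {a : ℝ} (ha : 3 ≤ a) :
    ∫ t in Ioi 0, t * sinh t * phiTerm a t = (∫ t in Ioi 0, cosh t * thetaTerm a t) / 4 := by
  have hφ : IntegrableOn (fun t ↦ t * sinh t * phiTerm a t) (Ioi 0) :=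
    integrableOn_mul_of_exp_decay (by fun_prop) (fun _ ↦ abs_mul_sinh_le)
      (continuous_phiTerm a).continuousOn (fun _ ↦ abs_phiTerm_le ha)
  have hθ : IntegrableOn (fun t ↦ cosh t * thetaTerm a t) (Ioi 0) :=
    integrableOn_mul_of_exp_decay (by fun_prop) (fun _ ↦ abs_cosh_le)
      (continuous_thetaTerm a).continuousOn (fun _ ↦ abs_thetaTerm_le ha)
  have hderiv (t : ℝ) : HasDerivAt
      (fun t ↦ t * sinh t * thetaTermDeriv a t - (sinh t + t * cosh t) * thetaTerm a t)
      (8 * (t * sinh t * phiTerm a t) - 2 * (cosh t * thetaTerm a t)) t := by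
    refine ((((hasDerivAt_id t).mul (hasDerivAt_sinh t)).mul (hasDerivAt_thetaTermDeriv a t)).sub
      (((hasDerivAt_sinh t).add ((hasDerivAt_id t).mul (hasDerivAt_cosh t))).mul
        (hasDerivAt_thetaTerm a t))).congr_deriv ?_
    simp only [id, Pi.mul_apply, Pi.add_apply]
    ring
  have hlim : Tendsto
      (fun t ↦ t * sinh t * thetaTermDeriv a t - (sinh t + t * cosh t) * thetaTerm a t)
      atTop (𝓝 0) := by
    have hexp : Tendsto (fun t : ℝ ↦ 64 * exp (-(a / 2)) * exp (-3 * t)) atTop (𝓝 0) := by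
      have h : Tendsto (fun t : ℝ ↦ exp (-3 * t)) atTop (𝓝 0) :=
        tendsto_exp_atBot.comp (tendsto_id.const_mul_atTop_of_neg (by norm_num))
      simpa using h.const_mul (64 * exp (-(a / 2)))
    refine squeeze_zero_norm' ?_ hexp
    filter_upwards [eventually_ge_atTop 0] with t ht
    have hsc : |sinh t + t * cosh t| ≤ 2 * exp (2 * t) := by
      have hs := sinh_nonneg_iff.2 ht
      rw [abs_of_nonneg (by have := cosh_pos t; positivity)]
      linarith [mul_le_exp_two_mul (cosh_pos t).le (cosh_le_exp ht),
        (sinh_le_exp t).trans (exp_le_exp.2 (by linarith : t ≤ 2 * t))]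
    have h1 : |t * sinh t * thetaTermDeriv a t| ≤
        exp (2 * t) * (32 * exp (-(a / 2)) * exp (-5 * t)) := by
      rw [abs_mul]
      exact mul_le_mul (abs_mul_sinh_le ht) (abs_thetaTermDeriv_le ha ht) (abs_nonneg _)
        (exp_pos _).le
    have h2 : |(sinh t + t * cosh t) * thetaTerm a t| ≤
        2 * exp (2 * t) * (16 * exp (-(a / 2)) * exp (-5 * t)) := by
      rw [abs_mul]
      exact mul_le_mul hsc (abs_thetaTerm_le ha ht) (abs_nonneg _) (by positivity)
    have h3 : exp (-3 * t) = exp (2 * t) * exp (-5 * t) := by rw [← exp_add]; ring_nf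
    refine (norm_sub_le _ _).trans ?_
    rw [norm_eq_abs, norm_eq_abs, h3]
    linarith
  have h := integral_Ioi_of_hasDerivAt_of_tendsto' (fun t _ ↦ hderiv t)
    ((hφ.const_mul 8).sub (hθ.const_mul 2)) hlim
  rw [integral_sub (hφ.const_mul 8) (hθ.const_mul 2), integral_const_mul, integral_const_mul] at h
  simp at h
  linarith

/-- The exponent coefficient `π (k+1)²`. -/
noncomputable def thetaCoeff (k : ℕ) : ℝ := π * (k + 1) ^ 2

lemma three_le_thetaCoeff (k : ℕ) : 3 ≤ thetaCoeff k := by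
  have : (1 : ℝ) ≤ (k + 1) ^ 2 := one_le_pow₀ (by simp)
  unfold thetaCoeff
  nlinarith [pi_gt_three]

lemma summable_exp_neg_half_thetaCoeff :
    Summable fun k ↦ 16 * exp (-(thetaCoeff k / 2)) := by
  refine (Summable.of_nonneg_of_le (fun _ ↦ (exp_pos _).le) (fun k ↦ ?_)
    summable_exp_neg_nat).mul_left 16
  rw [exp_le_exp, thetaCoeff]
  have : (0 : ℝ) ≤ k := k.cast_nonneg
  nlinarith [pi_gt_three, sq_nonneg (k : ℝ)]

lemma Phi_eq_tsum_phiTerm (t : ℝ) : Phi t = ∑' k, phiTerm (thetaCoeff k) t := by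
  refine tsum_congr fun k ↦ ?_
  rw [phiTerm, thetaCoeff]
  ring_nf

lemma Phi_nonneg {t : ℝ} (ht : 0 ≤ t) : 0 ≤ Phi t := by
  rw [Phi_eq_tsum_phiTerm]
  exact tsum_nonneg fun k ↦ phiTerm_nonneg (three_le_thetaCoeff k) ht

lemma continuousOn_Phi : ContinuousOn Phi (Ioi 0) :=
  (continuousOn_tsum_of_exp_decay (fun _ ↦ continuous_phiTerm _) summable_exp_neg_half_thetaCoeff
    (fun k _ ↦ abs_phiTerm_le (three_le_thetaCoeff k))).congr fun t _ ↦ Phi_eq_tsum_phiTerm t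

lemma integrableOn_mul_sinh_mul_Phi : IntegrableOn (fun t ↦ t * sinh t * Phi t) (Ioi 0) := by
  simp_rw [Phi_eq_tsum_phiTerm]
  exact integrableOn_mul_tsum_of_exp_decay (by fun_prop) (fun _ ↦ abs_mul_sinh_le)
    (fun k ↦ continuous_phiTerm _) summable_exp_neg_half_thetaCoeff
    (fun k _ ↦ abs_phiTerm_le (three_le_thetaCoeff k))

lemma integral_mul_sinh_mul_Phi :
    ∫ t in Ioi 0, t * sinh t * Phi t =
      (∫ t in Ioi 0, cosh t * ∑' k, thetaTerm (thetaCoeff k) t) / 4 := by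
  simp_rw [Phi_eq_tsum_phiTerm]
  refine HasSum.unique (hasSum_integral_mul_of_exp_decay (by fun_prop) (fun _ ↦ abs_mul_sinh_le)
    (fun k ↦ continuous_phiTerm _) summable_exp_neg_half_thetaCoeff
    (fun k _ ↦ abs_phiTerm_le (three_le_thetaCoeff k))) ?_
  simp_rw [fun k ↦ integral_mul_sinh_mul_phiTerm (three_le_thetaCoeff k)]
  exact (hasSum_integral_mul_of_exp_decay (by fun_prop) (fun _ ↦ abs_cosh_le)
    (fun k ↦ continuous_thetaTerm _) summable_exp_neg_half_thetaCoeff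
    (fun k _ ↦ abs_thetaTerm_le (three_le_thetaCoeff k))).div_const 4

lemma hasSum_mul_pow_div_factorial (t : ℝ) :
    HasSum (fun n : ℕ ↦ n * t ^ (2 * n) / (2 * n).factorial) (t * sinh t / 2) := by
  rw [← hasSum_nat_add_iff' 1]
  simp only [Finset.sum_range_one, Nat.cast_zero, zero_mul, zero_div, sub_zero]
  refine (((hasSum_sinh t).mul_left t).div_const 2).congr_fun fun n ↦ ?_
  rw [show 2 * (n + 1) = 2 * n + 1 + 1 by ring, Nat.factorial_succ]
  push_cast
  field_simp
  ring

lemma hasSum_turanMoment :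
    HasSum (fun n : ℕ ↦ n * turanMoment n / (2 * n).factorial)
      ((∫ t in Ioi 0, t * sinh t * Phi t) / 2) := by
  have hsum (t : ℝ) : HasSum (fun n : ℕ ↦ n * t ^ (2 * n) / (2 * n).factorial * Phi t)
      (t * sinh t * Phi t / 2) := by
    simpa [div_mul_eq_mul_div] using (hasSum_mul_pow_div_factorial t).mul_right (Phi t)
  have h := hasSum_integral_of_dominated_convergence (μ := volume.restrict (Ioi (0 : ℝ)))
    (F := fun (n : ℕ) t ↦ n * t ^ (2 * n) / (2 * n).factorial * Phi t)
    (f := fun t ↦ t * sinh t * Phi t / 2)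
    (fun n t ↦ n * t ^ (2 * n) / (2 * n).factorial * Phi t)
    (fun n ↦ (ContinuousOn.mul (by fun_prop) continuousOn_Phi).aestronglyMeasurable
      measurableSet_Ioi) (fun n ↦ ?_) (ae_of_all _ fun t ↦ (hsum t).summable) ?_
    (ae_of_all _ hsum)
  · rw [integral_div] at h
    refine h.congr_fun fun n ↦ ?_
    rw [turanMoment, ← integral_const_mul, ← integral_div]
    congr 1 with t
    ring
  · filter_upwards [ae_restrict_mem measurableSet_Ioi] with t ht
    have ht : 0 < t := ht
    have := Phi_nonneg ht.le
    rw [norm_of_nonneg (by positivity)]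
  · simp_rw [fun t ↦ (hsum t).tsum_eq]
    exact integrableOn_mul_sinh_mul_Phi.div_const 2

lemma evenKernel_zero_exp {t : ℝ} (ht : 0 ≤ t) :
    HurwitzZeta.evenKernel 0 (exp (4 * t)) =
      1 + 2 * exp (-t) * ∑' k, thetaTerm (thetaCoeff k) t := by
  have h := HurwitzZeta.hasSum_nat_cosKernel₀ 0 (exp_pos (4 * t))
  rw [HurwitzZeta.evenKernel_eq_cosKernel_of_zero, ← sub_eq_iff_eq_add']
  refine HasSum.unique h ?_
  refine ((summable_of_exp_decay summable_exp_neg_half_thetaCoeff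
    (fun k _ ↦ abs_thetaTerm_le (three_le_thetaCoeff k)) ht).hasSum.mul_left _).congr_fun fun k ↦ ?_
  have : exp (-t) * exp t = 1 := by rw [← exp_add]; simp
  simp only [thetaTerm, thetaCoeff, mul_zero, zero_mul, cos_zero, mul_one, neg_mul]
  linear_combination -2 * exp (-(π * (k + 1) ^ 2 * exp (4 * t))) * this

lemma f_modif_exp {t : ℝ} (ht : 0 < t) :
    (HurwitzZeta.hurwitzEvenFEPair 0).f_modif (exp (4 * t)) =
      ((2 * exp (-t) * ∑' k, thetaTerm (thetaCoeff k) t : ℝ) : ℂ) := by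
  have h1 : 1 < exp (4 * t) := one_lt_exp_iff.2 (by linarith)
  simp [WeakFEPair.f_modif, h1, notMem_Ioo_of_ge h1.le, HurwitzZeta.hurwitzEvenFEPair,
    evenKernel_zero_exp ht.le]

lemma f_modif_exp_neg {t : ℝ} (ht : 0 < t) :
    (HurwitzZeta.hurwitzEvenFEPair 0).f_modif (exp (-4 * t)) =
      ((2 * exp t * ∑' k, thetaTerm (thetaCoeff k) t : ℝ) : ℂ) := by
  have h := (HurwitzZeta.hurwitzEvenFEPair 0).hf_modif_FE _ (exp_pos (4 * t))
  have hg : (HurwitzZeta.hurwitzEvenFEPair 0).g_modif =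
      (HurwitzZeta.hurwitzEvenFEPair 0).f_modif :=
    congrArg WeakFEPair.f_modif HurwitzZeta.hurwitzEvenFEPair_zero_symm
  rw [hg, f_modif_exp ht, one_div, ← exp_neg] at h
  rw [neg_mul, h]
  have h2 : exp t = exp (4 * t) ^ (1 / 2 : ℝ) * exp (-t) := by
    rw [← exp_mul, ← exp_add]; ring_nf
  rw [h2]
  simp [HurwitzZeta.hurwitzEvenFEPair]
  ring

lemma image_exp_four_mul_Ioi : (fun t ↦ exp (4 * t)) '' Ioi 0 = Ioi 1 := by
  ext x
  constructor
  · rintro ⟨t, ht, rfl⟩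
    have ht : 0 < t := ht
    exact one_lt_exp_iff.2 (by linarith)
  · intro hx
    have hx : 1 < x := hx
    refine ⟨log x / 4, div_pos (log_pos hx) (by norm_num), ?_⟩
    simp only
    rw [mul_div_cancel₀ _ (by norm_num), exp_log (by linarith)]

lemma image_exp_neg_four_mul_Ioi : (fun t ↦ exp (-4 * t)) '' Ioi 0 = Ioo 0 1 := by
  ext x
  constructor
  · rintro ⟨t, ht, rfl⟩
    have ht : 0 < t := ht
    exact ⟨exp_pos _, exp_lt_one_iff.mpr (by linarith)⟩
  · rintro ⟨hx0, hx1⟩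
    refine ⟨log x / -4, div_pos_of_neg_of_neg (log_neg hx0 hx1) (by norm_num), ?_⟩
    simp only
    rw [mul_div_cancel₀ _ (by norm_num), exp_log hx0]

lemma injective_exp_const_mul {c : ℝ} (hc : c ≠ 0) : Function.Injective fun t ↦ exp (c * t) :=
  exp_injective.comp (mul_right_injective₀ hc)

lemma completedRiemannZeta₀_one_eq_integral :
    completedRiemannZeta₀ 1 =
      ((8 * ∫ t in Ioi 0, cosh t * ∑' k, thetaTerm (thetaCoeff k) t : ℝ) : ℂ) := by
  set P := HurwitzZeta.hurwitzEvenFEPair 0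
  set G : ℝ → ℝ := fun t ↦ ∑' k, thetaTerm (thetaCoeff k) t
  have hconv : IntegrableOn (fun x : ℝ ↦ (x : ℂ) ^ ((1 / 2 : ℂ) - 1) • P.f_modif x) (Ioi 0) :=
    (P.isStrongFEPair_toStrongFEPair.hasMellin (1 / 2)).1
  have hpow (c t : ℝ) : ((exp (c * t) : ℝ) : ℂ) ^ ((1 / 2 : ℂ) - 1) = (exp (-c / 2 * t) : ℝ) := by
    rw [show (1 / 2 : ℂ) - 1 = ((-1 / 2 : ℝ) : ℂ) by push_cast; norm_num,
      ← Complex.ofReal_cpow (exp_pos _).le, ← exp_mul]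
    ring_nf
  have hupper : ∫ x in Ioi (1 : ℝ), (x : ℂ) ^ ((1 / 2 : ℂ) - 1) • P.f_modif x =
      ((8 * ∫ t in Ioi 0, exp t * G t : ℝ) : ℂ) := by
    rw [← image_exp_four_mul_Ioi, integral_image_eq_integral_abs_deriv_smul measurableSet_Ioi
      (fun t _ ↦ (hasDerivAt_exp_mul_const 4 t).hasDerivWithinAt)
      (injective_exp_const_mul (by norm_num)).injOn, ← integral_const_mul,
      ← integral_complex_ofReal]
    refine setIntegral_congr_fun measurableSet_Ioi fun t ht ↦ ?_
    rw [hpow, f_modif_exp ht, abs_of_pos (by positivity), smul_eq_mul, Complex.real_smul]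
    rw [← Complex.ofReal_mul, ← Complex.ofReal_mul]
    congr 1
    have : exp t = exp (4 * t) * exp (-4 / 2 * t) * exp (-t) := by
      rw [← exp_add, ← exp_add]; ring_nf
    rw [this]
    ring
  have hlower : ∫ x in Ioo (0 : ℝ) 1, (x : ℂ) ^ ((1 / 2 : ℂ) - 1) • P.f_modif x =
      ((8 * ∫ t in Ioi 0, exp (-t) * G t : ℝ) : ℂ) := by
    rw [← image_exp_neg_four_mul_Ioi, integral_image_eq_integral_abs_deriv_smul measurableSet_Ioi
      (fun t _ ↦ (hasDerivAt_exp_mul_const (-4) t).hasDerivWithinAt)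
      (injective_exp_const_mul (by norm_num)).injOn, ← integral_const_mul,
      ← integral_complex_ofReal]
    refine setIntegral_congr_fun measurableSet_Ioi fun t ht ↦ ?_
    rw [hpow, f_modif_exp_neg ht, abs_mul, abs_of_pos (exp_pos _),
      show |(-4 : ℝ)| = 4 by norm_num, smul_eq_mul, Complex.real_smul]
    rw [← Complex.ofReal_mul, ← Complex.ofReal_mul]
    congr 1
    have : exp (-t) = exp (-4 * t) * exp (- -4 / 2 * t) * exp t := by
      rw [← exp_add, ← exp_add]; ring_nf
    rw [this]
    ring
  have hint (w : ℝ → ℝ) (hw : Continuous w) (hwb : ∀ t, 0 ≤ t → |w t| ≤ exp (2 * t)) :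
      IntegrableOn (fun t ↦ w t * G t) (Ioi 0) :=
    integrableOn_mul_tsum_of_exp_decay hw hwb (fun k ↦ continuous_thetaTerm _)
      summable_exp_neg_half_thetaCoeff (fun k _ ↦ abs_thetaTerm_le (three_le_thetaCoeff k))
  have hΛ : P.Λ₀ (1 / 2) = ((8 * ∫ t in Ioi 0, exp (-t) * G t : ℝ) : ℂ) +
      ((8 * ∫ t in Ioi 0, exp t * G t : ℝ) : ℂ) := by
    rw [← hupper, ← hlower, WeakFEPair.Λ₀, mellin, ← Ioc_union_Ioi_eq_Ioi zero_le_one,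
      setIntegral_union (by simp) measurableSet_Ioi
        (hconv.mono_set Ioc_subset_Ioi_self) (hconv.mono_set (Ioi_subset_Ioi zero_le_one)),
      integral_Ioc_eq_integral_Ioo]
  have hcosh : ∫ t in Ioi 0, cosh t * G t =
      ((∫ t in Ioi 0, exp t * G t) + ∫ t in Ioi 0, exp (-t) * G t) / 2 := by
    rw [← integral_add (hint _ (by fun_prop) fun t ht ↦ ?_)
      (hint _ (by fun_prop) fun t ht ↦ ?_), ← integral_div]
    · congr 1 with t
      rw [cosh_eq]
      ring
    · rw [abs_of_pos (exp_pos _), exp_le_exp]; linarith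
    · rw [abs_of_pos (exp_pos _), exp_le_exp]; linarith
  rw [completedRiemannZeta₀, HurwitzZeta.completedHurwitzZetaEven₀, hΛ, hcosh]
  push_cast
  ring

theorem eulerMascheroni_eq_log_four_pi_sub_two_add_turan_sum :
    Real.eulerMascheroniConstant =
      Real.log (4 * Real.pi) - 2 +
        128 * ∑' n : ℕ, (n : ℝ) * turanMoment n / (2 * n).factorial := by
  have h := completedRiemannZeta₀_one_eq_integral.symm.trans
    completedRiemannZeta₀_one
  rw [show (4 * π : ℂ) = ((4 * π : ℝ) : ℂ) by push_cast; rfl,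
    ← Complex.ofReal_log (by positivity)] at h
  norm_cast at h
  rw [hasSum_turanMoment.tsum_eq, integral_mul_sinh_mul_Phi]
  linarith
end
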